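/- For every odd natural number $n$, there exists a unique family of real coefficients $\{c_w : w \in \mathcal{C}^*(n)\}$ such that, in the Pöppe algebra of compositions, $\sum_{k=1}^{(n+1)/2} \sum_{(a_1,\dots,a_k)\in\mathcal{C}^*(n)} c_{a_1\cdots a_k}\cdot \widehat{\underline{a_1}} * \widehat{\underline{a_2}} * \cdots * \widehat{\underline{a_k}}$ equals the single-letter composition $n$. (Moreover $c_n = 1$.) -/

import Mathlib

open Finset

/-- The set of compositions of `n` (lists of positive integers summing to `n`). -/
def comps : ℕ → Finset (List ℕ+)
  | 0 => {[]}
  | n + 1 =>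
    (Finset.range (n + 1)).attach.biUnion fun k =>
      (comps k.1).image fun l =>
        (⟨n + 1 - k.1, Nat.sub_pos_of_lt (Finset.mem_range.mp k.2)⟩ : ℕ+) :: l
  decreasing_by exact Finset.mem_range.mp k.2

/-- Signature character of a composition. -/
def chi : List ℕ+ → ℕ
  | [] => 1
  | a :: t => Nat.choose ((a : ℕ) + (t.map fun x => (x : ℕ)).sum) (a : ℕ) * chi t

/-- The Pöppe product of two basis compositions `u a` and `b v`:
`(u a) * (b v) = u(a+1)bv + ua(b+1)v + 2·(ua1bv)`, as an element of the free
vector space on compositions (zero if either composition is empty). -/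
noncomputable def ppWord (u v : List ℕ+) : List ℕ+ →₀ ℝ :=
  match u.reverse, v with
  | a :: ur, b :: v' =>
      Finsupp.single (((a + 1) :: ur).reverse ++ b :: v') 1
      + Finsupp.single ((a :: ur).reverse ++ (b + 1) :: v') 1
      + (2 : ℝ) • Finsupp.single ((a :: ur).reverse ++ (1 : ℕ+) :: b :: v') 1
  | _, _ => 0

/-- The bilinear Pöppe product on the free vector space on compositions. -/
noncomputable def poppeMul (x y : List ℕ+ →₀ ℝ) : List ℕ+ →₀ ℝ :=
  x.sum fun u cu => y.sum fun v cv => (cu * cv) • ppWord u v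

/-- The signature expansion of order `n`: `∑_{w ⊨ n} χ(w)·w`. -/
noncomputable def sigExp (n : ℕ) : List ℕ+ →₀ ℝ :=
  ∑ w ∈ comps n, (chi w : ℝ) • Finsupp.single w 1

/-- The derivation of a single composition: the sum of all single-letter increments
plus the sum of all insertions of a letter `1` into the gaps. -/
noncomputable def derWord (w : List ℕ+) : List ℕ+ →₀ ℝ :=
  (∑ k ∈ Finset.range w.length,
      Finsupp.single (w.take k ++ (w.getD k 1 + 1) :: w.drop (k + 1)) (1 : ℝ))
  + ∑ k ∈ Finset.range (w.length + 1),
      Finsupp.single (w.take k ++ (1 : ℕ+) :: w.drop k) (1 : ℝ)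

/-- The derivation, extended linearly to the free vector space on compositions. -/
noncomputable def der (x : List ℕ+ →₀ ℝ) : List ℕ+ →₀ ℝ :=
  x.sum fun w c => c • derWord w

/-- The index set `𝒞*(n)`: compositions `(a₁,…,a_k)` of positive integers with
`a₁ + ⋯ + a_k = n - k + 1` and `1 ≤ k ≤ (n+1)/2`. -/
def Cstar (n : ℕ) : Finset (List ℕ+) :=
  (Finset.Icc 1 ((n + 1) / 2)).biUnion fun k =>
    (comps (n - k + 1)).filter fun w => w.length = k

/-- The Pöppe product of signature expansions `â₁ * â₂ * ⋯ * â_k` indexed by a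
composition `(a₁,…,a_k)`. -/
noncomputable def sigProd : List ℕ+ → (List ℕ+ →₀ ℝ)
  | [] => 0
  | [a] => sigExp (a : ℕ)
  | a :: l => poppeMul (sigExp (a : ℕ)) (sigProd l)

noncomputable section PoppeSec

namespace Poppe

set_option linter.unusedSimpArgs false

abbrev FA := FreeAlgebra ℝ Bool

def gd : FA := FreeAlgebra.ι ℝ false

def gs : FA := FreeAlgebra.ι ℝ true

def ka : FA := gd*gs+gs*gd+2*(gs*gs)

def delHom : FA →ₐ[ℝ] TrivSqZeroExt FA FA :=
  FreeAlgebra.lift ℝ (fun b => if b then TrivSqZeroExt.inl gs + TrivSqZeroExt.inr (gs*gd+gs*gs) else TrivSqZeroExt.inl gd)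

lemma delHom_fst (x : FA) : (delHom x).fst = x := by
  have : (TrivSqZeroExt.fstHom ℝ FA FA).comp delHom = AlgHom.id ℝ FA := by
    apply FreeAlgebra.hom_ext
    funext b
    cases b <;> simp [delHom, gd, gs]
  exact DFunLike.congr_fun this x

def del : FA →ₗ[ℝ] FA where
  toFun x := (delHom x).snd
  map_add' := by simp
  map_smul' := by simp

lemma del_mul (x y : FA) : del (x*y) = x * del y + del x * y := by
  simp [del, delHom_fst]

lemma del_d : del gd = 0 := by simp [del, delHom, gd]

lemma del_s : del gs = gs*gd+gs*gs := by simp [del, delHom, gs]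

lemma del_one : del 1 = 0 := by simp [del]

def dd : FA →ₗ[ℝ] FA where
  toFun x := (gd+gs)*x + x*gs + del x
  map_add' x y := by simp only [map_add, mul_add, add_mul]; abel
  map_smul' r x := by simp

lemma dd_apply (x : FA) : dd x = (gd+gs)*x + x*gs + del x := rfl

lemma dd_mul (x y : FA) : dd (x*ka*y) = dd x * ka * y + x * ka * dd y := by
  have h2 : del (2:FA) = 0 := by
    have : (2:FA) = 1 + 1 := by norm_num
    rw [this, map_add, del_one, add_zero]
  simp only [dd_apply, del_mul, ka, map_add, del_d, del_s, h2]
  noncomm_ring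

lemma dd_one : dd 1 = gd + 2*gs := by
  simp only [dd_apply, del_one]; noncomm_ring

lemma del_dpow (j : ℕ) : del (gd^j) = 0 := by
  induction j with
  | zero => simp [del_one]
  | succ j ih => rw [pow_succ, del_mul, ih, del_d]; simp

lemma dd_dpow (j : ℕ) : dd (gd^j) = gd^(j+1) + gs*gd^j + gd^j*gs := by
  rw [dd_apply, del_dpow, pow_succ' gd j]; noncomm_ring

lemma dd_dpow_s (j : ℕ) (y : FA) : dd (gd^j*gs*y) = gd^(j+1)*gs*y + gs*gd^j*gs*y + gd^j*gs*dd y := by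
  simp only [dd_apply, del_mul, del_dpow, del_s, pow_succ' gd j]; noncomm_ring

lemma dd_dd_dpow (j : ℕ) : dd (dd (gd^j)) - ka * gd^j - gd^j * ka
    = gd^(j+2) + gs*gd^(j+1) + gd^(j+1)*gs + 2*(gs*gd^j*gs) := by
  rw [dd_dpow]
  simp only [dd_apply, del_mul, map_add, del_dpow, del_s, ka]
  have h1 : gd^(j+2) = gd*gd*gd^j := by rw [pow_add, (Commute.refl gd).pow_pow]; noncomm_ring
  have h2 : gd^(j+1) = gd*gd^j := pow_succ' _ _
  have h3 : gd^j*gd = gd*gd^j := by rw [← pow_succ, pow_succ']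
  have h4 (x : FA): gd^j*(gd*x) = gd*(gd^j*x) := by rw [← mul_assoc, h3, mul_assoc]
  simp only [h1, h2, mul_add, add_mul, mul_assoc, h4]
  noncomm_ring

def H : ℕ → FA
  | 0 => 1
  | n+1 => dd (H n)

lemma H_rec (n : ℕ) : H n = gd^n + ∑ k ∈ Finset.range n, ((n+1).choose (k+1) : ℝ) • (gd^(n-1-k)*gs*H k) := by
  induction n with
  | zero => simp [H]
  | succ n ih =>
    have e1 : ∑ k ∈ Finset.range n, ((n+1).choose (k+1) : ℝ) • dd (gd^(n-1-k)*gs*H k)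
      = (∑ k ∈ Finset.range n, ((n+1).choose (k+1) : ℝ) • (gd^(n-k)*gs*H k))
       + gs * (∑ k ∈ Finset.range n, ((n+1).choose (k+1) : ℝ) • (gd^(n-1-k)*gs*H k))
       + ∑ k ∈ Finset.range n, ((n+1).choose (k+1) : ℝ) • (gd^(n-1-k)*gs*H (k+1)) := by
      rw [Finset.mul_sum, ← Finset.sum_add_distrib, ← Finset.sum_add_distrib]
      apply Finset.sum_congr rfl
      intro k hk
      have hk := Finset.mem_range.mp hk
      rw [dd_dpow_s, show n-1-k+1 = n-k by omega]
      simp only [smul_add, mul_smul_comm, mul_assoc, H]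
    have e2 : gs * H n = gs * gd^n + gs * (∑ k ∈ Finset.range n, ((n+1).choose (k+1) : ℝ) • (gd^(n-1-k)*gs*H k)) := by
      conv_lhs => rw [ih]
      rw [mul_add]
    have e3 : ∑ k ∈ Finset.range (n+1), ((n+1).choose k : ℝ) • (gd^(n-k)*gs*H k)
       = gd^n*gs + ∑ k ∈ Finset.range n, ((n+1).choose (k+1) : ℝ) • (gd^(n-1-k)*gs*H (k+1)) := by
      rw [Finset.sum_range_succ']
      simp [H, add_comm, Nat.sub_sub]
    have e4 : ∑ k ∈ Finset.range (n+1), ((n+1).choose (k+1) : ℝ) • (gd^(n-k)*gs*H k)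
       = gs * H n + ∑ k ∈ Finset.range n, ((n+1).choose (k+1) : ℝ) • (gd^(n-k)*gs*H k) := by
      rw [Finset.sum_range_succ]
      simp [add_comm]
    have e5 : ∑ k ∈ Finset.range (n+1), ((n+1+1).choose (k+1) : ℝ) • (gd^(n+1-1-k)*gs*H k)
      = ∑ k ∈ Finset.range (n+1), ((n+1).choose k : ℝ) • (gd^(n-k)*gs*H k)
       + ∑ k ∈ Finset.range (n+1), ((n+1).choose (k+1) : ℝ) • (gd^(n-k)*gs*H k) := by
      rw [← Finset.sum_add_distrib]
      apply Finset.sum_congr rfl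
      intro k _
      rw [Nat.choose_succ_succ]; push_cast
      rw [add_smul]
    rw [e5, e3, e4, e2]
    change dd (H n) = _
    conv_lhs => rw [ih]
    rw [map_add, map_sum, dd_dpow]
    simp only [map_smul]
    rw [e1]; abel

lemma idA {S : Type*} [Ring S] (z d s g : S) (hd : d*z=z*d) (hs : s*z=z*s) (hg : g*z=z*g) (hdg : g*d=d*g)
    (h : z*(d*(d*g)) = g-1) (k g' y : S) (hk : k = d*s+s*d+2*(s*s)) (hg' : g' = d*g+s*g+g*s) (hy : y = s*g-g*s) :
    y = z * (g*k*y + y*k*g + g*k*g' - g'*k*g) := by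
  have hd' (x) : d*(z*x)=z*(d*x) := by rw [← mul_assoc, hd, mul_assoc]
  have hs' (x) : s*(z*x)=z*(s*x) := by rw [← mul_assoc, hs, mul_assoc]
  have hg'' (x) : g*(z*x)=z*(g*x) := by rw [← mul_assoc, hg, mul_assoc]
  have hdg' (x) : g*(d*x)=d*(g*x) := by rw [← mul_assoc, hdg, mul_assoc]
  have h1 : g * s * (z*(d*(d*g))) = g*s*(g-1) := by rw [h]
  have h2 : (z*(d*(d*g))) * s * g = (g-1)*s*g := by rw [h]
  subst hk hg' hy
  simp only [mul_add, add_mul, mul_sub, sub_mul, mul_one, one_mul, mul_assoc, hd, hd', hs, hs', hg, hg'', hdg, hdg', two_mul] at h1 h2 ⊢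
  linear_combination (norm := abel) h2 - h1

lemma idB {S : Type*} [Ring S] (z d s g : S) (hd : d*z=z*d) (hs : s*z=z*s) (hg : g*z=z*g) (hdg : g*d=d*g)
    (h : z*(d*(d*g)) = g-1) (k v W Z : S) (hk : k = d*s+s*d+2*(s*s))
    (hv : v = d*d*g + s*d*g+d*g*s+2*(s*g*s)) (hW : W = 1 + z * v) (hZ : Z = d*g + 2*(s*g)) :
    g = W + z*(g*k*g) - 2*(z*(W*k*g)) + z*(z*(Z*k*Z)) := by
  have hd' (x) : d*(z*x)=z*(d*x) := by rw [← mul_assoc, hd, mul_assoc]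
  have hs' (x) : s*(z*x)=z*(s*x) := by rw [← mul_assoc, hs, mul_assoc]
  have hg'' (x) : g*(z*x)=z*(g*x) := by rw [← mul_assoc, hg, mul_assoc]
  have hdg' (x) : g*(d*x)=d*(g*x) := by rw [← mul_assoc, hdg, mul_assoc]
  have h0 (a b : S) : a * (z*(d*(d*g))) * b = a * (g-1) * b := by rw [h]
  have h1 := h0 z (s*d*g)
  have h2 := h0 (z*d*g*s) 1
  have h3 := h0 (z*s) (s*g)
  have h4 := h0 (z*s*g*s) 1
  have h5 := h0 z (s*s*g)
  have h6 := h0 z (k*g)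
  subst hk hv hW hZ
  clear h0
  simp only [mul_add, add_mul, mul_sub, sub_mul, mul_one, one_mul, mul_assoc, hd, hd', hs, hs', hg, hg'', hdg, hdg', two_mul] at h h1 h2 h3 h4 h5 h6 ⊢
  linear_combination (norm := abel) h6 + h6 - h - h1 - h2 + h3 + h3 - h4 - h4 - h5 - h5

/-- Sum of the letters of a composition. -/
def wt (w : List ℕ+) : ℕ := (w.map fun x => (x : ℕ)).sum

lemma wt_cons (a : ℕ+) (w : List ℕ+) : wt (a :: w) = a + wt w := by simp [wt]

lemma wt_append (u w : List ℕ+) : wt (u ++ w) = wt u + wt w := by simp [wt]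

lemma len_le_wt (w : List ℕ+) : w.length ≤ wt w := by
  induction w with
  | nil => simp
  | cons a t ih => rw [wt_cons, List.length_cons]; have := a.pos; omega

/-- Product of signature expansions in the free algebra. -/
def sigP : List ℕ+ → FA
  | [] => 0
  | [a] => H a.natPred
  | a :: l => H a.natPred * ka * sigP l

lemma sigP_cons (a : ℕ+) (l : List ℕ+) (hl : l ≠ []) : sigP (a :: l) = H a.natPred * ka * sigP l := by
  cases l with
  | nil => exact absurd rfl hl
  | cons b t => rfl

lemma sigP_append (u w : List ℕ+) (hu : u ≠ []) (hw : w ≠ []) : sigP (u ++ w) = sigP u * ka * sigP w := by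
  induction u with
  | nil => exact absurd rfl hu
  | cons a t ih =>
    rcases eq_or_ne t [] with rfl | ht
    · rw [List.singleton_append, sigP_cons _ _ hw]; rfl
    · rw [List.cons_append, sigP_cons _ _ (by simp [ht]), sigP_cons _ _ ht, ih ht]
      simp only [mul_assoc]

def idx (k : ℕ) : Set (List ℕ+) := {w | w ≠ [] ∧ wt w + w.length = k + 2}

/-- The graded pieces of the subalgebra generated by signature expansions. -/
def A (k : ℕ) : Submodule ℝ FA := Submodule.span ℝ (sigP '' idx k)

lemma sigP_mem {w : List ℕ+} {k : ℕ} (h : w ≠ []) (h2 : wt w + w.length = k + 2) : sigP w ∈ A k :=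
  Submodule.subset_span ⟨w, ⟨h, h2⟩, rfl⟩

lemma A_mul {i j k : ℕ} {x y : FA} (hx : x ∈ A i) (hy : y ∈ A j) (hk : k = i + j + 2) :
    x * ka * y ∈ A k := by
  induction hx using Submodule.span_induction with
  | mem x hx =>
    obtain ⟨u, ⟨hu, hu2⟩, rfl⟩ := hx
    induction hy using Submodule.span_induction with
    | mem y hy =>
      obtain ⟨v, ⟨hv, hv2⟩, rfl⟩ := hy
      rw [← sigP_append u v hu hv]
      apply sigP_mem (by simp [hu])
      rw [wt_append, List.length_append]; omega
    | zero => simp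
    | add x y _ _ h1 h2 => rw [mul_add]; exact add_mem h1 h2
    | smul r x _ h => rw [mul_smul_comm]; exact Submodule.smul_mem _ _ h
  | zero => simp
  | add x y _ _ h1 h2 => rw [add_mul, add_mul]; exact add_mem h1 h2
  | smul r x _ h => rw [smul_mul_assoc, smul_mul_assoc]; exact Submodule.smul_mem _ _ h

lemma H_mem (n : ℕ) : H n ∈ A n := by
  have := @sigP_mem [n.succPNat] n (by simp) (by simp [wt])
  simpa [sigP] using this

lemma one_mem : (1 : FA) ∈ A 0 := H_mem 0

lemma dd_sigP (w : List ℕ+) (hw : w ≠ []) (k : ℕ) (hk : wt w + w.length = k + 2) : dd (sigP w) ∈ A (k+1) := by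
  induction w generalizing k with
  | nil => exact absurd rfl hw
  | cons a t ih =>
    rw [wt_cons, List.length_cons] at hk
    have ha : a.natPred + 1 = a := PNat.natPred_add_one a
    rcases eq_or_ne t [] with rfl | ht
    · have := H_mem (a.natPred + 1)
      have hk' : a.natPred = k := by simp [wt] at hk; omega
      rw [← hk']; exact this
    · rw [sigP_cons _ _ ht, dd_mul]
      have h1 := len_le_wt t
      have h2 := List.length_pos_iff.mpr ht
      have h3 : wt t + t.length = (wt t + t.length - 2) + 2 := by omega
      exact add_mem (A_mul (H_mem (a.natPred+1)) (sigP_mem ht h3) (by omega))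
        (A_mul (H_mem _) (ih ht _ h3) (by omega))

lemma A_dd {k : ℕ} {x : FA} (hx : x ∈ A k) : dd x ∈ A (k+1) := by
  induction hx using Submodule.span_induction with
  | mem x hx =>
    obtain ⟨u, ⟨hu, hu2⟩, rfl⟩ := hx
    exact dd_sigP u hu k hu2
  | zero => simp
  | add x y _ _ h1 h2 => rw [map_add]; exact add_mem h1 h2
  | smul r x _ h => rw [map_smul]; exact Submodule.smul_mem _ _ h

abbrev PS := PowerSeries FA

/-- The first `N` coefficients are in the right graded pieces. -/
def Good (N a : ℕ) (f : PS) : Prop := ∀ i < N, PowerSeries.coeff i f ∈ A (2*i+a)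

lemma Good.add {N a : ℕ} {f h : PS} (hf : Good N a f) (hh : Good N a h) : Good N a (f+h) := by
  intro i hi; rw [map_add]; exact add_mem (hf i hi) (hh i hi)

lemma Good.sub {N a : ℕ} {f h : PS} (hf : Good N a f) (hh : Good N a h) : Good N a (f-h) := by
  intro i hi; rw [map_sub]; exact sub_mem (hf i hi) (hh i hi)

def ck : PS := PowerSeries.C ka

lemma Good.mul {N a b : ℕ} {f h : PS} (hf : Good N a f) (hh : Good N b h) (k : ℕ) (hk : k = a+b+2) :
    Good N k (f * ck * h) := by
  intro i hi
  rw [ck, PowerSeries.coeff_mul]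
  apply Submodule.sum_mem
  rintro ⟨p, q⟩ hpq
  rw [Finset.HasAntidiagonal.mem_antidiagonal] at hpq
  dsimp only at hpq ⊢
  rw [PowerSeries.coeff_mul_C]
  exact A_mul (hf p (by omega)) (hh q (by omega)) (by omega)

lemma Good.X {N a : ℕ} {f : PS} (hf : Good N (a+2) f) : Good (N+1) a (PowerSeries.X * f) := by
  intro i hi
  cases i with
  | zero => rw [PowerSeries.coeff_zero_X_mul]; exact zero_mem _
  | succ i =>
    rw [PowerSeries.coeff_succ_X_mul]
    have := hf i (by omega)
    rwa [show 2*(i+1)+a = 2*i+(a+2) by ring]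

lemma Good.mono {N M a : ℕ} {f : PS} (hf : Good N a f) (h : M ≤ N) : Good M a f :=
  fun i hi => hf i (by omega)

lemma Good.one (N : ℕ) : Good N 0 1 := by
  intro i hi
  rw [PowerSeries.coeff_one]
  split_ifs with h
  · subst h; exact one_mem
  · exact zero_mem _

def g : PS := PowerSeries.mk fun i => gd^(2*i)
def cd : PS := PowerSeries.C gd
def cs : PS := PowerSeries.C gs
def g1 : PS := PowerSeries.mk fun i => dd (gd^(2*i))
def y : PS := cs * g - g * cs
def v : PS := PowerSeries.mk fun i => dd (dd (gd^(2*i))) - ka * gd^(2*i) - gd^(2*i)*ka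

lemma cd_g : g * cd = cd * g := by
  ext i
  rw [cd, PowerSeries.coeff_mul_C, PowerSeries.coeff_C_mul, g, PowerSeries.coeff_mk, ← pow_succ, pow_succ']

lemma X_g : PowerSeries.X * (cd * (cd * g)) = g - 1 := by
  ext i
  cases i with
  | zero => simp [g]
  | succ i =>
    rw [PowerSeries.coeff_succ_X_mul, cd, PowerSeries.coeff_C_mul, PowerSeries.coeff_C_mul]
    simp only [g, map_sub, PowerSeries.coeff_mk, PowerSeries.coeff_one, Nat.succ_ne_zero, if_false, sub_zero]
    rw [show 2*(i+1) = 2*i+1+1 by ring, pow_succ', pow_succ']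

lemma ck_eq : ck = cd*cs+cs*cd+2*(cs*cs) := by
  have : (2 : PS) = PowerSeries.C 2 := (map_ofNat PowerSeries.C 2).symm
  rw [this]
  simp only [ck, cd, cs, ← map_mul, ← map_add, ka]

lemma g1_eq : g1 = cd*g+cs*g+g*cs := by
  ext i
  simp only [cd, cs, map_add, PowerSeries.coeff_mul_C, PowerSeries.coeff_C_mul, g, g1, PowerSeries.coeff_mk, dd_dpow,
    pow_succ']

lemma v_eq : v = cd*cd*g + cs*cd*g+cd*g*cs+2*(cs*g*cs) := by
  ext i
  simp only [cd, cs, map_add, mul_assoc, two_mul, PowerSeries.coeff_mul_C, PowerSeries.coeff_C_mul, g, v,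
    PowerSeries.coeff_mk, dd_dd_dpow, pow_succ']

lemma good_all (N : ℕ) : Good N 0 g ∧ Good N 1 y := by
  induction N with
  | zero => exact ⟨fun i hi => absurd hi (by omega), fun i hi => absurd hi (by omega)⟩
  | succ N ih =>
    obtain ⟨hg, hy⟩ := ih
    have hg1 : Good N 1 g1 := by
      intro i hi
      have := hg i hi
      rw [g, PowerSeries.coeff_mk] at this
      rw [g1, PowerSeries.coeff_mk]
      exact A_dd this
    have hv : Good N 2 v := by
      intro i hi
      have := hg i hi
      rw [g, PowerSeries.coeff_mk] at this
      rw [v, PowerSeries.coeff_mk]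
      refine sub_mem (sub_mem (A_dd (A_dd this)) ?_) ?_
      · have := A_mul one_mem this (k := 2*i+2) (by omega)
        rwa [one_mul] at this
      · have := A_mul this one_mem (k := 2*i+2) (by omega)
        rwa [mul_one] at this
    have hX (f : PS) : f * PowerSeries.X = PowerSeries.X * f := PowerSeries.X_mul.symm
    constructor
    · have hZ : g1 + y = cd*g+2*(cs*g) := by
        rw [g1_eq, y]; noncomm_ring
      have hGZ : Good N 1 (g1 + y) := hg1.add hy
      have hW : Good (N+1) 0 (1 + PowerSeries.X * v) := (Good.one _).add hv.X
      have hWN := hW.mono (Nat.le_succ N)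
      have key := idB PowerSeries.X cd cs g (hX _) (hX _) (hX _) cd_g X_g ck v _ (g1+y) ck_eq v_eq rfl hZ
      rw [key, two_mul]
      have t1 : Good (N+1) 0 (PowerSeries.X * ((1 + PowerSeries.X * v) * ck * g)) := (hWN.mul hg 2 rfl).X
      have t2 : Good (N+1) 0 (PowerSeries.X * (g * ck * g)) := (hg.mul hg 2 rfl).X
      have t3 : Good (N+1) 0 (PowerSeries.X * (PowerSeries.X * ((g1+y) * ck * (g1+y)))) := by
        have u1 : Good N 4 ((g1+y) * ck * (g1+y)) := Good.mul hGZ hGZ 4 rfl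
        have u2 : Good (N+1) 2 (PowerSeries.X * ((g1+y) * ck * (g1+y))) := u1.X
        have u3 : Good N 2 (PowerSeries.X * ((g1+y) * ck * (g1+y))) := u2.mono (Nat.le_succ N)
        exact u3.X
      exact ((hW.add t2).sub (t1.add t1)).add t3
    · have key := idA PowerSeries.X cd cs g (hX _) (hX _) (hX _) cd_g X_g ck g1 y ck_eq g1_eq rfl
      rw [key]
      exact Good.X ((((hg.mul hy 3 rfl).add (hy.mul hg 3 rfl)).add (hg.mul hg1 3 rfl)).sub (hg1.mul hg 3 rfl))

lemma dpow_mem (m : ℕ) : gd^(2*m) ∈ A (2*m) := by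
  have := (good_all (m+1)).1 m (by omega)
  rwa [g, PowerSeries.coeff_mk] at this

abbrev M := List ℕ+ →₀ ℝ

def incW : List ℕ+ → M
  | [] => 0
  | a :: t => Finsupp.single ((a+1) :: t) 1

def consW : List ℕ+ → M
  | [] => 0
  | a :: t => Finsupp.single (1 :: a :: t) 1

/-- The free algebra acting on the space of compositions. -/
def rep : FA →ₐ[ℝ] Module.End ℝ M :=
  FreeAlgebra.lift ℝ (fun b => if b then Finsupp.linearCombination ℝ consW else Finsupp.linearCombination ℝ incW)

lemma rep_d (w : List ℕ+) : rep gd (Finsupp.single w 1) = incW w := by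
  simp [rep, gd]

lemma rep_s (w : List ℕ+) : rep gs (Finsupp.single w 1) = consW w := by
  simp [rep, gs]

def ppB : M →ₗ[ℝ] M →ₗ[ℝ] M :=
  Finsupp.lsum ℝ fun u => LinearMap.toSpanSingleton ℝ _ (Finsupp.linearCombination ℝ (ppWord u))

lemma ppB_single (u w : List ℕ+) : ppB (Finsupp.single u 1) (Finsupp.single w 1) = ppWord u w := by
  simp [ppB]

lemma poppeMul_eq (x y : M) : poppeMul x y = ppB x y := by
  simp only [poppeMul, ppB, Finsupp.lsum_apply, Finsupp.sum, LinearMap.sum_apply,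
    LinearMap.toSpanSingleton_apply, LinearMap.smul_apply, Finsupp.linearCombination_apply, Finset.smul_sum, mul_smul]

lemma ppWord_nil_left (w : List ℕ+) : ppWord [] w = 0 := by simp [ppWord]

lemma ppWord_nil_right (w : List ℕ+) : ppWord w [] = 0 := by
  unfold ppWord; split <;> simp_all

lemma ppWord_snoc (u : List ℕ+) (a b : ℕ+) (w : List ℕ+) : ppWord (u ++ [a]) (b :: w) =
    Finsupp.single (u ++ (a+1) :: b :: w) 1 + Finsupp.single (u ++ a :: (b+1) :: w) 1
      + (2:ℝ) • Finsupp.single (u ++ a :: 1 :: b :: w) 1 := by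
  simp [ppWord]

lemma ppB_gen (c : Bool) (x y : M) : ppB (rep (FreeAlgebra.ι ℝ c) x) y = rep (FreeAlgebra.ι ℝ c) (ppB x y) := by
  have key : ppB ∘ₗ (rep (FreeAlgebra.ι ℝ c)) = (LinearMap.compRight ℝ (rep (FreeAlgebra.ι ℝ c))) ∘ₗ ppB := by
    apply Finsupp.lhom_ext'
    intro u
    apply LinearMap.ext_ring
    apply Finsupp.lhom_ext'
    intro w
    apply LinearMap.ext_ring
    simp only [LinearMap.comp_apply, Finsupp.lsingle_apply, LinearMap.compRight_apply, ppB_single]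
    have hd := rep_d
    have hs := rep_s
    rw [gd] at hd
    rw [gs] at hs
    cases w with
    | nil =>
      rw [ppWord_nil_right, map_zero]
      cases c
      · rw [hd]; cases u <;> simp [incW, ppB_single, ppWord_nil_right]
      · rw [hs]; cases u <;> simp [consW, ppB_single, ppWord_nil_right]
    | cons b w =>
      rcases List.eq_nil_or_concat u with rfl | ⟨u, a, rfl⟩
      · rw [ppWord_nil_left, map_zero]
        cases c
        · rw [hd]; simp [incW]
        · rw [hs]; simp [consW]
      · simp only [List.concat_eq_append]
        rw [ppWord_snoc]
        simp only [map_add, map_smul]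
        cases c
        · simp only [hd]
          cases u with
          | nil =>
            have := ppWord_snoc [] (a+1) b w
            simp only [List.nil_append] at this
            simp only [incW, List.nil_append, ppB_single, this]
          | cons p u =>
            have := ppWord_snoc ((p+1)::u) a b w
            simp only [List.cons_append] at this
            simp only [incW, List.cons_append, ppB_single, this]
        · simp only [hs]
          cases u with
          | nil =>
            have := ppWord_snoc [1] a b w
            simp only [List.cons_append, List.nil_append] at this
            simp only [consW, List.nil_append, ppB_single, this]
          | cons p u =>
            have := ppWord_snoc (1::p::u) a b w
            simp only [List.cons_append] at this
            simp only [consW, List.cons_append, ppB_single, this]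
  exact congrArg (fun f => f y) (LinearMap.congr_fun key x)

lemma ppB_rep (a : FA) (x y : M) : ppB (rep a x) y = rep a (ppB x y) := by
  induction a using FreeAlgebra.induction generalizing x with
  | grade0 r => simp [Algebra.algebraMap_eq_smul_one]
  | grade1 c => exact ppB_gen c x y
  | mul a b ha hb => rw [map_mul, Module.End.mul_apply, ha, hb]; rfl
  | add a b ha hb => simp only [map_add, LinearMap.add_apply, ha, hb]

/-- Evaluation at the one-letter composition `1`. -/
def Psi (x : FA) : M := rep x (Finsupp.single [1] 1)

lemma ppB_one (y : M) : ppB (Finsupp.single [1] 1) y = rep ka y := by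
  have key : ppB (Finsupp.single [1] 1) = rep ka := by
    apply Finsupp.lhom_ext'
    intro w
    apply LinearMap.ext_ring
    have h2 : (2 : Module.End ℝ M) = (2:ℝ) • 1 := by
      ext; simp [two_smul, Module.End.ofNat_apply]
    simp only [LinearMap.comp_apply, Finsupp.lsingle_apply, ppB_single, ka, map_add, map_mul, map_ofNat,
      LinearMap.add_apply, Module.End.mul_apply, rep_s, rep_d, h2, LinearMap.smul_apply, Module.End.one_apply]
    cases w with
    | nil => simp [incW, consW, ppWord_nil_right]
    | cons b w =>
      have := ppWord_snoc [] 1 b w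
      simp only [List.nil_append] at this
      rw [this]
      simp [incW, consW, rep_s, rep_d]
  rw [key]

lemma poppe_Psi (x : FA) (y : M) : poppeMul (Psi x) y = rep (x * ka) y := by
  rw [poppeMul_eq, Psi, ppB_rep, ppB_one, map_mul]; rfl

lemma rep_dpow (j : ℕ) (a c : ℕ+) (w : List ℕ+) (hc : (c : ℕ) = a + j) :
    rep (gd^j) (Finsupp.single (a :: w) 1) = Finsupp.single (c :: w) 1 := by
  induction j generalizing c with
  | zero =>
    have : c = a := PNat.eq (by simpa using hc)
    simp [this]
  | succ j ih =>
    have e : c = (a + j - 1).succPNat + 1 := PNat.eq (by have := a.pos; simp; omega)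
    rw [pow_succ', map_mul, Module.End.mul_apply, ih (a + j - 1).succPNat (by have := a.pos; simp; omega), rep_d, e]
    rfl

lemma rep_dpow_s (j : ℕ) (w : List ℕ+) (hw : w ≠ []) :
    rep (gd^j*gs) (Finsupp.single w 1) = Finsupp.single (j.succPNat :: w) 1 := by
  cases w with
  | nil => exact absurd rfl hw
  | cons a t =>
    rw [map_mul, Module.End.mul_apply, rep_s, consW]
    exact rep_dpow _ _ _ _ (by simp [add_comm])

lemma comps_succ (n : ℕ) : comps (n+1) = (Finset.range (n+1)).biUnion fun k =>
    (comps k).image fun l => (n-k).succPNat :: l := by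
  have e (k : ℕ) (h : k < n + 1) : (⟨n + 1 - k, Nat.sub_pos_of_lt h⟩ : ℕ+) = (n-k).succPNat := by
    apply PNat.eq
    change n + 1 - k = (n - k) + 1
    omega
  ext w
  rw [comps]
  constructor
  · intro h
    obtain ⟨⟨k, hk⟩, _, h⟩ := Finset.mem_biUnion.mp h
    obtain ⟨l, hl, rfl⟩ := Finset.mem_image.mp h
    refine Finset.mem_biUnion.mpr ⟨k, hk, Finset.mem_image.mpr ⟨l, hl, ?_⟩⟩
    exact congrArg (· :: l) (e k (Finset.mem_range.mp hk)).symm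
  · intro h
    obtain ⟨k, hk, h⟩ := Finset.mem_biUnion.mp h
    obtain ⟨l, hl, rfl⟩ := Finset.mem_image.mp h
    refine Finset.mem_biUnion.mpr ⟨⟨k, hk⟩, Finset.mem_attach _ _, Finset.mem_image.mpr ⟨l, hl, ?_⟩⟩
    exact congrArg (· :: l) (e k (Finset.mem_range.mp hk))

lemma mem_comps (n : ℕ) (w : List ℕ+) : w ∈ comps n ↔ wt w = n := by
  induction n using Nat.strong_induction_on generalizing w with
  | _ n ih =>
    cases n with
    | zero =>
      rw [comps]
      cases w with
      | nil => simp [wt]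
      | cons a t => have := a.pos; simp [wt_cons]
    | succ n =>
      rw [comps_succ]
      simp only [Finset.mem_biUnion, Finset.mem_image, Finset.mem_range]
      constructor
      · rintro ⟨k, hk, l, hl, rfl⟩
        rw [ih k hk] at hl
        rw [wt_cons, hl]; simp; omega
      · intro h
        cases w with
        | nil => simp [wt] at h
        | cons a t =>
          rw [wt_cons] at h
          have := a.pos
          refine ⟨wt t, by omega, t, (ih _ (by omega) _).mpr rfl, ?_⟩
          congr 1
          apply PNat.eq
          simp; omega

lemma sigExp_rec (n : ℕ) : sigExp (n+1) = ∑ k ∈ Finset.range (n+1), ((n+1).choose k : ℝ) •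
    ∑ w ∈ comps k, (chi w : ℝ) • Finsupp.single ((n-k).succPNat :: w) 1 := by
  rw [sigExp, comps_succ, Finset.sum_biUnion]
  · apply Finset.sum_congr rfl
    intro k hk
    have hk' := Finset.mem_range.mp hk
    rw [Finset.sum_image (by intro a _ b _ h; simpa using h), Finset.smul_sum]
    apply Finset.sum_congr rfl
    intro w hw
    rw [mem_comps] at hw
    have : chi ((n-k).succPNat :: w) = (n+1).choose k * chi w := by
      rw [chi]
      have hw' : (w.map fun x => (x : ℕ)).sum = k := hw
      rw [hw']
      have : ((n-k).succPNat : ℕ) + k = n + 1 := by simp; omega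
      rw [this]
      congr 1
      rw [← Nat.choose_symm (by omega : k ≤ n+1)]
      congr 1
      simp; omega
    rw [this]; push_cast; rw [mul_smul]
  · intro k hk l hl hne
    rw [Function.onFun, Finset.disjoint_left]
    intro w h1 h2
    simp only [Finset.mem_image] at h1 h2
    obtain ⟨u, hu, rfl⟩ := h1
    obtain ⟨u', hu', h⟩ := h2
    rw [mem_comps] at hu hu'
    apply hne
    simp only [List.cons.injEq] at h
    rw [← hu, ← hu', h.2]

lemma sigExp_Psi (n : ℕ) : sigExp (n+1) = Psi (H n) := by
  induction n using Nat.strong_induction_on with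
  | _ n ih =>
    rw [H_rec, sigExp_rec, Finset.sum_range_succ', Psi, map_add, map_sum, LinearMap.add_apply, LinearMap.sum_apply,
      add_comm]
    congr 1
    · rw [rep_dpow n 1 n.succPNat [] (by simp [add_comm])]
      simp [comps, chi]
    · apply Finset.sum_congr rfl
      intro k hk
      have hk' := Finset.mem_range.mp hk
      rw [map_smul, LinearMap.smul_apply, map_mul, Module.End.mul_apply]
      congr 1
      have := ih k hk'
      rw [Psi] at this
      rw [← this, sigExp, map_sum]
      apply Finset.sum_congr rfl
      intro w hw
      rw [mem_comps] at hw
      rw [map_smul, rep_dpow_s _ _ (by rintro rfl; simp [wt] at hw), Nat.sub_sub, add_comm 1 k]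

lemma sigExp_pnat (a : ℕ+) : sigExp (a : ℕ) = Psi (H a.natPred) := by
  rw [← sigExp_Psi, PNat.natPred_add_one]

lemma sigProd_cons (a : ℕ+) (l : List ℕ+) (hl : l ≠ []) :
    sigProd (a :: l) = rep (H a.natPred * ka) (sigProd l) := by
  cases l with
  | nil => exact absurd rfl hl
  | cons b t => rw [← poppe_Psi, ← sigExp_pnat]; rfl

lemma sigProd_Psi (w : List ℕ+) : sigProd w = Psi (sigP w) := by
  induction w with
  | nil => simp [sigProd, sigP, Psi]
  | cons a t ih =>
    rcases eq_or_ne t [] with rfl | ht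
    · exact sigExp_pnat a
    · rw [sigProd_cons _ _ ht, ih, sigP_cons _ _ ht, Psi, Psi, map_mul _ _ (sigP t)]; rfl

lemma mem_Cstar (n : ℕ) (w : List ℕ+) : w ∈ Cstar n ↔ w ≠ [] ∧ wt w + w.length = n + 1 := by
  simp only [Cstar, Finset.mem_biUnion, Finset.mem_Icc, Finset.mem_filter, mem_comps]
  have h1 := len_le_wt w
  constructor
  · rintro ⟨k, hk, h, h2⟩
    refine ⟨?_, by omega⟩
    rintro rfl
    simp at h2; omega
  · rintro ⟨h, h2⟩
    have h3 := List.length_pos_iff.mpr h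
    exact ⟨w.length, by omega, by omega, rfl⟩

/-! Triangularity. -/

/-- The leading composition of a product of signature expansions. -/
def lead : List ℕ+ → List ℕ+
  | [] => []
  | [a] => [a]
  | a :: l => (a + 1) :: lead l

lemma lead_cons (a : ℕ+) (l : List ℕ+) (hl : l ≠ []) : lead (a :: l) = (a+1) :: lead l := by
  cases l with
  | nil => exact absurd rfl hl
  | cons b t => rfl

lemma lead_ne (l : List ℕ+) (hl : l ≠ []) : lead l ≠ [] := by
  cases l with
  | nil => exact absurd rfl hl
  | cons b t => cases t <;> simp [lead]

lemma coeff_ds (j : ℕ) (m : M) (c : ℕ+) (u : List ℕ+) :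
    rep (gd^j*gs) m (c :: u) = if c = j.succPNat ∧ u ≠ [] then m u else 0 := by
  induction m using Finsupp.induction_linear with
  | zero => simp
  | add f h hf hh => rw [map_add, Finsupp.add_apply, hf, hh]; split_ifs <;> simp
  | single w r =>
    have : (Finsupp.single w r : M) = r • Finsupp.single w 1 := by simp
    rw [this, map_smul, Finsupp.smul_apply, Finsupp.smul_apply]
    rcases eq_or_ne w [] with rfl | hw
    · rw [map_mul, Module.End.mul_apply, rep_s, consW, map_zero]
      split_ifs with h
      · simp [Finsupp.single_apply, h.2.symm]
      · simp
    · rw [rep_dpow_s _ _ hw]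
      simp only [Finsupp.single_apply, List.cons.injEq]
      split_ifs <;> simp_all

lemma Hk_eq (n : ℕ) : H n * ka = gd^(n+1)*gs + gd^n*gs*(gd+2*gs) +
    ∑ k ∈ Finset.range n, ((n+1).choose (k+1) : ℝ) • (gd^(n-1-k)*gs*(H k*ka)) := by
  conv_lhs => rw [H_rec]
  rw [add_mul, Finset.sum_mul]
  congr 1
  · rw [ka, pow_succ]; noncomm_ring
  · apply Finset.sum_congr rfl
    intro k _
    rw [smul_mul_assoc]; simp only [mul_assoc]

lemma coeff_Hk (b : ℕ) (m : M) (c : ℕ+) (u : List ℕ+) (hc : b + 2 ≤ c) :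
    rep (H b * ka) m (c :: u) = if (c : ℕ) = b + 2 ∧ u ≠ [] then m u else 0 := by
  have hne (j : ℕ) (hj : j ≤ b) : ¬ (c = j.succPNat ∧ u ≠ []) := by
    rintro ⟨rfl, _⟩; simp at hc; omega
  rw [Hk_eq, map_add, map_add, map_sum, LinearMap.add_apply, LinearMap.add_apply, LinearMap.sum_apply,
    Finsupp.add_apply, Finsupp.add_apply, coeff_ds, map_mul _ _ (gd + 2*gs), Module.End.mul_apply, coeff_ds,
    if_neg (hne b le_rfl), Finsupp.finsetSum_apply, Finset.sum_eq_zero]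
  · have : (c = (b+1).succPNat) ↔ (c : ℕ) = b + 2 := by
      rw [← PNat.coe_inj]; simp
    simp only [this, add_zero]
  · intro k hk
    rw [map_smul, LinearMap.smul_apply, Finsupp.smul_apply, map_mul _ _ (H k * ka), Module.End.mul_apply, coeff_ds,
      if_neg (hne _ (by omega)), smul_zero]

lemma coeff_H (n : ℕ) : Psi (H n) [n.succPNat] = 1 := by
  rw [H_rec, Psi, map_add, map_sum, LinearMap.add_apply, LinearMap.sum_apply, Finsupp.add_apply,
    Finsupp.finsetSum_apply, Finset.sum_eq_zero, rep_dpow n 1 n.succPNat [] (by simp [add_comm])]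
  · simp
  · intro k hk
    rw [map_smul, LinearMap.smul_apply, Finsupp.smul_apply, map_mul _ _ (H k), Module.End.mul_apply, coeff_ds,
      if_neg (by simp), smul_zero]

lemma coeff_lead_self (w : List ℕ+) (hw : w ≠ []) : sigProd w (lead w) = 1 := by
  induction w with
  | nil => exact absurd rfl hw
  | cons a t ih =>
    rcases eq_or_ne t [] with rfl | ht
    · have := coeff_H a.natPred
      rw [← sigExp_pnat, PNat.succPNat_natPred] at this
      exact this
    · have ha : a.natPred + 1 = a := PNat.natPred_add_one a
      rw [sigProd_cons _ _ ht, lead_cons _ _ ht, coeff_Hk _ _ _ _ (by rw [PNat.add_coe, PNat.one_coe]; omega), if_pos, ih ht]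
      exact ⟨by rw [PNat.add_coe, PNat.one_coe]; omega, lead_ne _ ht⟩

lemma coeff_lead_lt (w w' : List ℕ+) (hw : w ≠ []) (hw' : w' ≠ []) (h : wt w + w.length = wt w' + w'.length)
    (hlt : w' < w) : sigProd w' (lead w) = 0 := by
  induction w generalizing w' with
  | nil => exact absurd rfl hw
  | cons a t ih =>
    cases w' with
    | nil => exact absurd rfl hw'
    | cons b t' =>
      have ha : a.natPred + 1 = a := PNat.natPred_add_one a
      have hb : b.natPred + 1 = b := PNat.natPred_add_one b
      have l1 := len_le_wt t
      have l2 := len_le_wt t'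
      rw [List.cons_lt_cons_iff] at hlt
      rw [wt_cons, wt_cons, List.length_cons, List.length_cons] at h
      have hba : (b : ℕ) ≤ a := by
        rcases hlt with h | h
        · exact_mod_cast h.le
        · rw [h.1]
      rcases eq_or_ne t' [] with rfl | ht'
      · exfalso
        simp [wt] at h
        rcases hlt with h' | ⟨h', h''⟩
        · have : (b : ℕ) < a := by exact_mod_cast h'
          omega
        · subst h'
          have : t = [] := by
            apply List.eq_nil_of_length_eq_zero; omega
          subst this
          exact lt_irrefl _ h''
      · have p2 := List.length_pos_iff.mpr ht'
        rw [sigProd_cons _ _ ht']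
        rcases eq_or_ne t [] with rfl | ht
        · have w0 : wt ([] : List ℕ+) = 0 := rfl
          rw [w0, List.length_nil] at h
          change rep _ _ [a] = 0
          rw [coeff_Hk _ _ _ _ (by omega), if_neg (by simp)]
        · rw [lead_cons _ _ ht, coeff_Hk _ _ _ _ (by rw [PNat.add_coe, PNat.one_coe]; omega)]
          split_ifs with hc
          · have hab : (b : ℕ) = a := by have := hc.1; rw [PNat.add_coe, PNat.one_coe] at this; omega
            have hab' : b = a := PNat.eq hab
            subst hab'
            rcases hlt with h' | ⟨_, h'⟩
            · exact absurd h' (lt_irrefl _)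
            · exact ih t' ht ht' (by omega) h'
          · rfl

lemma indep (n : ℕ) (c : List ℕ+ → ℝ) (hc : ∑ w ∈ Cstar n, c w • sigProd w = 0) : ∀ w ∈ Cstar n, c w = 0 := by
  by_contra! hcon
  obtain ⟨w0, hw0, hne⟩ := hcon
  obtain ⟨w, hw, hmax⟩ := Finset.exists_max_image ((Cstar n).filter fun w => c w ≠ 0) id ⟨w0, by simp [hw0, hne]⟩
  rw [Finset.mem_filter] at hw
  have := congrArg (fun f : M => f (lead w)) hc
  simp only [Finsupp.finsetSum_apply, Finsupp.smul_apply, Finsupp.coe_zero, Pi.zero_apply] at this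
  have hw1 := (mem_Cstar _ _).mp hw.1
  rw [Finset.sum_eq_single w, coeff_lead_self _ hw1.1, smul_eq_mul, mul_one] at this
  · exact hw.2 this
  · intro w' hw' hww
    by_cases h0 : c w' = 0
    · simp [h0]
    · have h2 := (mem_Cstar _ _).mp hw'
      have hlt : w' < w := lt_of_le_of_ne (hmax w' (by simp [hw', h0])) hww
      rw [coeff_lead_lt w w' hw1.1 h2.1 (by omega) hlt, smul_zero]
  · intro h; exact absurd hw.1 h

lemma le_single (n : ℕ+) (w : List ℕ+) (hw : w ∈ Cstar n) (hne : w ≠ [n]) : w < [n] := by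
  obtain ⟨h, h2⟩ := (mem_Cstar _ _).mp hw
  cases w with
  | nil => exact absurd rfl h
  | cons a t =>
    rw [List.cons_lt_cons_iff]
    left
    rw [wt_cons, List.length_cons] at h2
    have ht : t ≠ [] := by
      rintro rfl
      apply hne
      congr 1
      apply PNat.eq
      have w0 : wt ([] : List ℕ+) = 0 := rfl
      rw [w0, List.length_nil] at h2
      omega
    have := List.length_pos_iff.mpr ht
    have := len_le_wt t
    rw [← PNat.coe_lt_coe]
    omega

lemma exists_coeff (N : ℕ+) (hn : Odd (N : ℕ)) : ∃ c : List ℕ+ → ℝ, (∀ w ∉ Cstar N, c w = 0) ∧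
    (∑ w ∈ Cstar N, c w • sigProd w) = Finsupp.single [N] 1 := by
  obtain ⟨m, hm⟩ := hn
  rw [hm]
  have h := dpow_mem m
  have hidx : idx (2*m) = ↑(Cstar (2*m+1)) := by
    ext w; rw [Finset.mem_coe, mem_Cstar]; rfl
  rw [A, hidx, Submodule.mem_span_image_finset_iff_exists_fun] at h
  obtain ⟨c, hc⟩ := h
  refine ⟨fun w => if h : w ∈ Cstar (2*m+1) then c ⟨w, h⟩ else 0, fun w hw => dif_neg hw, ?_⟩
  have e : ∑ w ∈ Cstar (2*m+1), (if h : w ∈ Cstar (2*m+1) then c ⟨w, h⟩ else 0) • sigProd w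
      = Psi (gd^(2*m)) := by
    rw [← hc, Psi, map_sum, LinearMap.sum_apply, ← Finset.sum_coe_sort]
    apply Finset.sum_congr rfl
    rintro ⟨w, hw⟩ _
    rw [dif_pos hw, map_smul, LinearMap.smul_apply, sigProd_Psi]; rfl
  rw [e, Psi, rep_dpow _ _ N _ (by rw [hm, PNat.one_coe, add_comm])]

lemma main (N : ℕ+) (hn : Odd (N : ℕ)) : ∃! c : List ℕ+ → ℝ, (∀ w ∉ Cstar N, c w = 0) ∧
    (∑ w ∈ Cstar N, c w • sigProd w) = Finsupp.single [N] 1 ∧ c [N] = 1 := by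
  obtain ⟨c, hc0, hc⟩ := exists_coeff N hn
  have hN : [N] ∈ Cstar N := by
    rw [mem_Cstar]; simp [wt]
  refine ⟨c, ⟨hc0, hc, ?_⟩, ?_⟩
  · have := congrArg (fun f : List ℕ+ →₀ ℝ => f (lead [N])) hc
    simp only [Finsupp.finsetSum_apply, Finsupp.smul_apply] at this
    have hr : (Finsupp.single [N] (1:ℝ)) (lead [N]) = 1 := by
      simp [lead]
    rw [hr, Finset.sum_eq_single [N], coeff_lead_self _ (by simp), smul_eq_mul,
      mul_one] at this
    · exact this
    · intro w hw hne
      have h1 := (mem_Cstar _ _).mp hw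
      have h2 := (mem_Cstar _ _).mp hN
      rw [coeff_lead_lt _ w (by simp) h1.1 (by omega) (le_single _ w hw hne), smul_zero]
    · intro h; exact absurd hN h
  · rintro c' ⟨h0, h1, _⟩
    have := indep N (fun w => c' w - c w) (by
      simp only [sub_smul, Finset.sum_sub_distrib, h1, hc, sub_self])
    funext w
    by_cases hw : w ∈ Cstar N
    · exact sub_eq_zero.mp (this w hw)
    · rw [h0 w hw, hc0 w hw]

end Poppe

end PoppeSec

/-- Main result (integrability): for every odd `n` there is a unique family of real
coefficients `{c_w : w ∈ 𝒞*(n)}` with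
`∑_{w = (a₁,…,a_k) ∈ 𝒞*(n)} c_w · â₁ * ⋯ * â_k = n` in the Pöppe algebra;
moreover `c_n = 1`. -/
theorem kdv_hierarchy_existence_uniqueness (n : ℕ) (hn : Odd n) :
    ∃! c : List ℕ+ → ℝ,
      (∀ w ∉ Cstar n, c w = 0) ∧
      (∑ w ∈ Cstar n, c w • sigProd w)
        = Finsupp.single [(⟨n, hn.pos⟩ : ℕ+)] 1 ∧
      c [(⟨n, hn.pos⟩ : ℕ+)] = 1 := by
  exact Poppe.main ⟨n, hn.pos⟩ hn
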